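/- For all positive integers p and q and every choice of j_1, …, j_p ∈ [q], the set W = ⋃_{i=1}^p {a^i_{j_i}, b^i_{j_i}} is the unique set S ⊆ V(G_{p,q}) \ {s,t} that is simultaneously a vertex (s,t)-cut of G_{p,q} and a member of 𝓘_W; in particular, G_{p,q} has exactly one vertex (s,t)-cut that is independent in the matroid M_W = (V(G_{p,q}), 𝓘_W). -/

import Mathlib

/-- The vertex set of the graph `G_{p,q}`: vertices `s`, `t`, `a i j` and `b i j`
for `i ∈ [p]`, `j ∈ [q]`. -/
inductive Vpq (p q : ℕ) : Type where
  | s : Vpq p q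
  | t : Vpq p q
  | a : Fin p → Fin q → Vpq p q
  | b : Fin p → Fin q → Vpq p q
  deriving DecidableEq, Fintype

/-- The base adjacency relation of `G_{p,q}` (to be symmetrized): for each `i`,
`s` is adjacent to `a i 1` and `b i 1`, `t` is adjacent to `a i q` and `b i q`,
and for each `j ∈ [q−1]` each of `a i j` and `b i j` is adjacent to both
`a i (j+1)` and `b i (j+1)`. -/
def basePQ (p q : ℕ) : Vpq p q → Vpq p q → Prop
  | .s, .a _ j => j.val = 0
  | .s, .b _ j => j.val = 0
  | .a _ j, .t => j.val = q - 1
  | .b _ j, .t => j.val = q - 1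
  | .a i j, .a i' j' => i = i' ∧ j'.val = j.val + 1
  | .a i j, .b i' j' => i = i' ∧ j'.val = j.val + 1
  | .b i j, .a i' j' => i = i' ∧ j'.val = j.val + 1
  | .b i j, .b i' j' => i = i' ∧ j'.val = j.val + 1
  | _, _ => False

/-- The graph `G_{p,q}`. -/
def Gpq (p q : ℕ) : SimpleGraph (Vpq p q) := SimpleGraph.fromRel (basePQ p q)

/-- The set `W = ⋃_{i=1}^p {a^i_{j_i}, b^i_{j_i}}` determined by `j : Fin p → Fin q`. -/
def WSet (p q : ℕ) (jv : Fin p → Fin q) : Finset (Vpq p q) :=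
  Finset.image (fun i => Vpq.a i (jv i)) Finset.univ ∪
    Finset.image (fun i => Vpq.b i (jv i)) Finset.univ

/-- The family `𝓘_W` of independent sets of the matroid `M_W` (with `k = 2p`):
subsets of `V(G_{p,q}) \ {s,t}` of size at most `k − 1` are independent; sets
containing `s` or `t` or of size at least `k + 1` are not; a set `X` of size `k` is
independent iff `X = W`, or `|A_i ∩ X| ≥ 2` or `|B_i ∩ X| ≥ 2` for some `i`, or
`a^i_h, b^i_j ∈ X` for some `i` and distinct `h, j`. -/
def IndW (p q : ℕ) (jv : Fin p → Fin q) (X : Finset (Vpq p q)) : Prop :=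
  Vpq.s ∉ X ∧ Vpq.t ∉ X ∧
    (X.card ≤ 2 * p - 1 ∨
      (X.card = 2 * p ∧
        (X = WSet p q jv ∨
          ∃ i : Fin p,
            (∃ j j' : Fin q, j ≠ j' ∧ Vpq.a i j ∈ X ∧ Vpq.a i j' ∈ X) ∨
            (∃ j j' : Fin q, j ≠ j' ∧ Vpq.b i j ∈ X ∧ Vpq.b i j' ∈ X) ∨
            (∃ h j : Fin q, h ≠ j ∧ Vpq.a i h ∈ X ∧ Vpq.b i j ∈ X))))

/-- Reachability in the undirected graph `G` after deleting the vertex set `S`. -/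
def ReachAvoid {V : Type*} (G : SimpleGraph V) (S : Set V) (u v : V) : Prop :=
  Relation.ReflTransGen (fun x y => G.Adj x y ∧ x ∉ S ∧ y ∉ S) u v

/-- `S` is a vertex (s,t)-cut of the undirected graph `G`. -/
def IsVertexCut {V : Type*} (G : SimpleGraph V) (s t : V) (S : Set V) : Prop :=
  s ∉ S ∧ t ∉ S ∧ ¬ ReachAvoid G S s t

theorem mem_WSet_a {p q : ℕ} {c : Fin p → Fin q} {i : Fin p} {j : Fin q} :
    Vpq.a i j ∈ WSet p q c ↔ j = c i := by
  simp [WSet, eq_comm]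

theorem mem_WSet_b {p q : ℕ} {c : Fin p → Fin q} {i : Fin p} {j : Fin q} :
    Vpq.b i j ∈ WSet p q c ↔ j = c i := by
  simp [WSet, eq_comm]

theorem s_notMem_WSet {p q : ℕ} (c : Fin p → Fin q) : Vpq.s ∉ WSet p q c := by
  simp [WSet]

theorem t_notMem_WSet {p q : ℕ} (c : Fin p → Fin q) : Vpq.t ∉ WSet p q c := by
  simp [WSet]

theorem card_WSet {p q : ℕ} (c : Fin p → Fin q) : (WSet p q c).card = 2 * p := by
  rw [WSet, Finset.card_union_of_disjoint, Finset.card_image_of_injective,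
    Finset.card_image_of_injective, Finset.card_univ, Fintype.card_fin, two_mul]
  · intro i j h
    exact (Vpq.b.inj h).1
  · intro i j h
    exact (Vpq.a.inj h).1
  · simp [Finset.disjoint_left]

/-- The vertices `s` and those in a column strictly before `c i`: the side of `s` in the
separation given by `WSet p q c`. -/
def SourceSide {p q : ℕ} (c : Fin p → Fin q) : Vpq p q → Prop
  | .s => True
  | .t => False
  | .a i j => j < c i
  | .b i j => j < c i

theorem SourceSide.of_adj {p q : ℕ} {c : Fin p → Fin q} {x y : Vpq p q} (hx : SourceSide c x)
    (hxy : (Gpq p q).Adj x y) (hy : y ∉ WSet p q c) : SourceSide c y := by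
  rw [Gpq, SimpleGraph.fromRel_adj] at hxy
  obtain ⟨-, h⟩ := hxy
  cases x <;> cases y <;>
    simp only [SourceSide, basePQ, mem_WSet_a, mem_WSet_b, Fin.lt_def, Fin.ext_iff] at * <;>
    grind

theorem isVertexCut_WSet {p q : ℕ} (c : Fin p → Fin q) :
    IsVertexCut (Gpq p q) Vpq.s Vpq.t (WSet p q c : Set (Vpq p q)) := by
  refine ⟨mod_cast s_notMem_WSet c, mod_cast t_notMem_WSet c, fun h => ?_⟩
  have key : ∀ v, ReachAvoid (Gpq p q) (WSet p q c : Set (Vpq p q)) Vpq.s v → SourceSide c v := by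
    intro v hv
    induction hv with
    | refl => trivial
    | tail _ hxy ih => exact ih.of_adj hxy.1 (mod_cast hxy.2.2)
  exact key _ h

/-- Every vertex cut contains, for each `i`, both vertices of some column. -/
theorem IsVertexCut.exists_column {p q : ℕ} (hq : 0 < q) {S : Set (Vpq p q)}
    (hS : IsVertexCut (Gpq p q) Vpq.s Vpq.t S) (i : Fin p) :
    ∃ j, Vpq.a i j ∈ S ∧ Vpq.b i j ∈ S := by
  by_contra! hne
  obtain ⟨hs, ht, hcut⟩ := hS
  have hv : ∀ j, ∃ v, v ∉ S ∧ (v = Vpq.a i j ∨ v = Vpq.b i j) := by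
    intro j
    by_cases ha : Vpq.a i j ∈ S
    · exact ⟨_, hne j ha, Or.inr rfl⟩
    · exact ⟨_, ha, Or.inl rfl⟩
  choose v hvS hv using hv
  have reach : ∀ n (hn : n < q), ReachAvoid (Gpq p q) S Vpq.s (v ⟨n, hn⟩) := by
    intro n
    induction n with
    | zero =>
      intro hn
      refine Relation.ReflTransGen.single ⟨?_, hs, hvS _⟩
      rcases hv ⟨0, hn⟩ with h | h <;> rw [h] <;> simp [Gpq, basePQ]
    | succ n ih =>
      intro hn
      refine (ih (by lia)).tail ⟨?_, hvS _, hvS _⟩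
      rcases hv ⟨n, by lia⟩ with h | h <;> rcases hv ⟨n + 1, hn⟩ with h' | h' <;>
        rw [h, h'] <;> simp [Gpq, basePQ]
  refine hcut ((reach (q - 1) (by lia)).tail ⟨?_, hvS _, ht⟩)
  rcases hv ⟨q - 1, by lia⟩ with h | h <;> rw [h] <;> simp [Gpq, basePQ]

/-- Every vertex cut contains some `WSet p q c`. -/
theorem IsVertexCut.exists_WSet_subset {p q : ℕ} (hq : 0 < q) {S : Finset (Vpq p q)}
    (hS : IsVertexCut (Gpq p q) Vpq.s Vpq.t (S : Set (Vpq p q))) :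
    ∃ c, WSet p q c ⊆ S := by
  choose c hc using hS.exists_column hq
  refine ⟨c, Finset.union_subset ?_ ?_⟩ <;> rw [Finset.image_subset_iff]
  · exact fun i _ => (hc i).1
  · exact fun i _ => (hc i).2

theorem indW_WSet {p q : ℕ} (c : Fin p → Fin q) : IndW p q c (WSet p q c) :=
  ⟨s_notMem_WSet c, t_notMem_WSet c, Or.inr ⟨card_WSet c, Or.inl rfl⟩⟩

theorem IsVertexCut.eq_WSet_of_indW {p q : ℕ} (hp : 0 < p) (hq : 0 < q) {jv : Fin p → Fin q}
    {S : Finset (Vpq p q)} (hS : IsVertexCut (Gpq p q) Vpq.s Vpq.t (S : Set (Vpq p q)))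
    (hI : IndW p q jv S) : S = WSet p q jv := by
  obtain ⟨c, hc⟩ := hS.exists_WSet_subset hq
  have hle := Finset.card_le_card hc
  rw [card_WSet] at hle
  obtain ⟨-, -, hlt | ⟨hcard, hW | ⟨i, h⟩⟩⟩ := hI
  · lia
  · exact hW
  · obtain rfl := Finset.eq_of_subset_of_card_le hc (by rw [card_WSet, hcard])
    simp only [mem_WSet_a, mem_WSet_b] at h
    grind

/-- `W = ⋃_{i=1}^p {a^i_{j_i}, b^i_{j_i}}` is the unique set
`S ⊆ V(G_{p,q}) \ {s,t}` that is simultaneously a vertex (s,t)-cut of `G_{p,q}` and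
a member of `𝓘_W`; in particular, `G_{p,q}` has exactly one vertex (s,t)-cut that is
independent in the matroid `M_W`. -/
theorem stmt18 (p q : ℕ) (hp : 0 < p) (hq : 0 < q) (jv : Fin p → Fin q) :
    (∀ S : Finset (Vpq p q),
      (IsVertexCut (Gpq p q) Vpq.s Vpq.t (S : Set (Vpq p q)) ∧ IndW p q jv S) ↔
        S = WSet p q jv) ∧
    (∃! S : Finset (Vpq p q),
      IsVertexCut (Gpq p q) Vpq.s Vpq.t (S : Set (Vpq p q)) ∧ IndW p q jv S) := by
  have key : ∀ S : Finset (Vpq p q),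
      (IsVertexCut (Gpq p q) Vpq.s Vpq.t (S : Set (Vpq p q)) ∧ IndW p q jv S) ↔
        S = WSet p q jv := by
    refine fun S => ⟨fun h => h.1.eq_WSet_of_indW hp hq h.2, ?_⟩
    rintro rfl
    exact ⟨isVertexCut_WSet jv, indW_WSet jv⟩
  exact ⟨key, WSet p q jv, (key _).2 rfl, fun S hS => (key S).1 hS⟩
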